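/- Let N > 0, ω ∈ [−N/2, N/2), ε_0 > 0 with ε_0 N < 1, and β > 1. Set ε_j = β^j ε_0 for 0 ≤ j ≤ m, and let δ = min((1 − ε_0 N)/2, 1/(2β + 2)). Suppose b_0, b_1, …, b_m ∈ ℝ satisfy ‖ε_j ω − b_j‖_ℤ < δ for all 0 ≤ j ≤ m. Define recursively λ_0 = (b_0 mod [−1/2, 1/2))/ε_0 and, for 1 ≤ j ≤ m, λ_j = ((b_j − ε_j(λ_0 + ⋯ + λ_{j−1})) mod [−1/2, 1/2))/ε_j. Then the estimate ω̃ := λ_0 + λ_1 + ⋯ + λ_m satisfies |ω̃ − ω| ≤ (δ/ε_0) β^{−m}. -/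

import Mathlib

/-- The Lee norm of `x`: the distance from `x` to the nearest integer. -/
noncomputable def leeNorm (x : ℝ) : ℝ := ⨅ k : ℤ, |x - (k : ℝ)|

/-- `x mod [-1/2, 1/2)`: the unique `y ∈ [-1/2, 1/2)` with `x - y ∈ ℤ`. -/
noncomputable def modHalf (x : ℝ) : ℝ := Int.fract (x + 1/2) - 1/2

/-- If `c` approximates `t` modulo `1` up to `δ` and `|t| + δ ≤ 1/2`, then no wrap-around occurs:
`modHalf c` approximates `t` up to `δ`. -/
theorem abs_modHalf_sub_lt {t c δ : ℝ} (h : leeNorm (t - c) < δ) (ht : |t| + δ ≤ 1 / 2) :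
    |modHalf c - t| < δ := by
  obtain ⟨k, hk⟩ := exists_lt_of_ciInf_lt h
  have hc : modHalf c = c + k := by
    have hfract : Int.fract (c + 1 / 2) = c + k + 1 / 2 := by
      rw [abs_lt] at hk
      refine Int.fract_eq_iff.2 ⟨?_, ?_, -k, by push_cast; ring⟩ <;>
        linarith [le_abs_self t, neg_abs_le t]
    rw [modHalf, hfract]
    ring
  rwa [hc, abs_sub_comm, ← sub_sub]

/-- Theorem 4.4: with geometric shifts `ε j = β^j * ε₀`, `β > 1`, `ε₀ N < 1`, and
`δ = min ((1 - ε₀ N)/2) (1/(2β + 2))`, if `‖ε j * ω - b j‖_ℤ < δ` for `0 ≤ j ≤ m`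
then the multiscale estimate `ω̃ = λ 0 + ⋯ + λ m` satisfies
`|ω̃ - ω| ≤ (δ/ε₀) β^{-m}`. -/
theorem multiscale_estimate_latitude (N : ℝ) (hN : 0 < N) (ω : ℝ)
    (hω₁ : -(N/2) ≤ ω) (hω₂ : ω < N/2)
    (ε₀ : ℝ) (hε₀ : 0 < ε₀) (hε₀N : ε₀ * N < 1)
    (β : ℝ) (hβ : 1 < β)
    (m : ℕ) (ε : ℕ → ℝ)
    (hε : ∀ j ≤ m, ε j = β ^ j * ε₀)
    (δ : ℝ) (hδ : δ = min ((1 - ε₀ * N) / 2) (1 / (2 * β + 2)))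
    (b : ℕ → ℝ)
    (hb : ∀ j ≤ m, leeNorm (ε j * ω - b j) < δ)
    (lam : ℕ → ℝ)
    (hlam₀ : lam 0 = modHalf (b 0) / ε 0)
    (hlam : ∀ j, 1 ≤ j → j ≤ m →
      lam j = modHalf (b j - ε j * ∑ i ∈ Finset.range j, lam i) / ε j) :
    |(∑ j ∈ Finset.range (m + 1), lam j) - ω| ≤ (δ / ε₀) * β ^ (-(m : ℤ)) := by
  have hβ₀ : 0 < β := by linarith
  have hδ₁ : δ ≤ (1 - ε₀ * N) / 2 := hδ ▸ min_le_left _ _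
  have hδ₂ : β * δ + δ ≤ 1 / 2 := by
    have h : δ ≤ 1 / (2 * β + 2) := hδ ▸ min_le_right _ _
    rw [le_div_iff₀ (by positivity)] at h
    linarith
  have herr : ∀ j ≤ m, β ^ j * ε₀ * |(∑ i ∈ Finset.range (j + 1), lam i) - ω| ≤ δ := by
    intro j
    induction j with
    | zero =>
      intro hj
      have hε0 : ε 0 = ε₀ := by simp [hε 0 hj]
      have hω : |ε₀ * ω| ≤ ε₀ * (N / 2) := by
        rw [abs_mul, abs_of_pos hε₀]
        gcongr
        exact abs_le.2 ⟨hω₁, hω₂.le⟩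
      have h := abs_modHalf_sub_lt (hε0 ▸ hb 0 hj) (by linarith)
      rw [zero_add, Finset.sum_range_one, hlam₀, hε0, pow_zero, one_mul]
      nth_rewrite 1 [← abs_of_pos hε₀]
      rw [← abs_mul, mul_sub, mul_div_cancel₀ _ hε₀.ne']
      exact h.le
    | succ j ih =>
      intro hj
      have hprev := ih (by omega)
      have hεj := hε (j + 1) hj
      have hpos : 0 < ε (j + 1) := by rw [hεj]; positivity
      set S := ∑ i ∈ Finset.range (j + 1), lam i with hS
      have hres : |ε (j + 1) * (ω - S)| ≤ β * δ := by
        rw [abs_mul, abs_of_pos hpos, hεj, abs_sub_comm]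
        calc β ^ (j + 1) * ε₀ * |S - ω| = β * (β ^ j * ε₀ * |S - ω|) := by ring
          _ ≤ β * δ := by gcongr
      have hlee : leeNorm (ε (j + 1) * (ω - S) - (b (j + 1) - ε (j + 1) * S)) < δ := by
        convert hb (j + 1) hj using 2
        ring
      have h := abs_modHalf_sub_lt hlee (by linarith)
      rw [Finset.sum_range_succ, ← hS, hlam (j + 1) (by omega) hj, ← hS, ← hεj]
      nth_rewrite 1 [← abs_of_pos hpos]
      rw [← abs_mul, mul_sub, mul_add, mul_div_cancel₀ _ hpos.ne']
      refine le_of_eq_of_le ?_ h.le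
      congr 1
      ring
  have h := herr m le_rfl
  rw [zpow_neg, zpow_natCast, ← div_eq_mul_inv, div_div, le_div_iff₀ (by positivity)]
  linarith
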